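/- For every ν ≥ 0 and every x > ν, V_{θup_ν}(x) − (1 − (ν² − 1/4)/x² − (2ν² + x²)/(x² − ν²)²) = (4ν² + 3x²)/(4(x² − ν²)²); in particular V_{θup_ν}(x) > 1 − (ν² − 1/4)/x² − (2ν² + x²)/(x² − ν²)² for all x > ν. -/

import Mathlib

/-- The potential `V_f` associated with a function `f` via Liouville's transformation. -/
noncomputable def potential (f : ℝ → ℝ) (x : ℝ) : ℝ :=
  (deriv f x) ^ 2 + (1 / 2) * (deriv (deriv (deriv f)) x / deriv f x)
    - (3 / 4) * (deriv (deriv f) x / deriv f x) ^ 2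

/-- The upper bound for the Bessel phase function:
`θup_ν(x) := √(x² − ν²) − ν·arccos(ν/x) − π/4`. -/
noncomputable def thetaUp (ν x : ℝ) : ℝ :=
  Real.sqrt (x ^ 2 - ν ^ 2) - ν * Real.arccos (ν / x) - Real.pi / 4

theorem hasDerivAt_sqrt_sq_sub_sq {ν x : ℝ} (h : 0 < x ^ 2 - ν ^ 2) :
    HasDerivAt (fun y => √(y ^ 2 - ν ^ 2)) (x / √(x ^ 2 - ν ^ 2)) x := by
  refine (((hasDerivAt_pow 2 x).sub_const (ν ^ 2)).sqrt h.ne').congr_deriv ?_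
  have hs : 0 < √(x ^ 2 - ν ^ 2) := Real.sqrt_pos.2 h
  field_simp
  norm_num

theorem hasDerivAt_thetaUp {ν x : ℝ} (hν : 0 ≤ ν) (hx : ν < x) :
    HasDerivAt (thetaUp ν) (√(x ^ 2 - ν ^ 2) / x) x := by
  have hx0 : 0 < x := hν.trans_lt hx
  have h : 0 < x ^ 2 - ν ^ 2 := by nlinarith
  have hs : 0 < √(x ^ 2 - ν ^ 2) := Real.sqrt_pos.2 h
  have hs2 : √(x ^ 2 - ν ^ 2) ^ 2 = x ^ 2 - ν ^ 2 := Real.sq_sqrt h.le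
  have hdiv : HasDerivAt (fun y => ν / y) (-(ν / x ^ 2)) x := by
    simpa [div_eq_mul_inv] using (hasDerivAt_inv hx0.ne').const_mul ν
  have hlt : ν / x < 1 := (div_lt_one hx0).2 hx
  have hnonneg : 0 ≤ ν / x := by positivity
  have harccos := (Real.hasDerivAt_arccos (by linarith) hlt.ne).comp x hdiv
  have hsqrt : √(1 - (ν / x) ^ 2) = √(x ^ 2 - ν ^ 2) / x := by
    rw [show 1 - (ν / x) ^ 2 = (x ^ 2 - ν ^ 2) / x ^ 2 by field_simp, Real.sqrt_div h.le,
      Real.sqrt_sq hx0.le]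
  rw [hsqrt] at harccos
  refine (((hasDerivAt_sqrt_sq_sub_sq h).sub (harccos.const_mul ν)).sub_const (Real.pi / 4)).congr_deriv ?_
  field_simp
  linear_combination -hs2

theorem hasDerivAt_sqrt_sq_sub_sq_div {ν x : ℝ} (hν : 0 ≤ ν) (hx : ν < x) :
    HasDerivAt (fun y => √(y ^ 2 - ν ^ 2) / y) (ν ^ 2 / (x ^ 2 * √(x ^ 2 - ν ^ 2))) x := by
  have hx0 : 0 < x := hν.trans_lt hx
  have h : 0 < x ^ 2 - ν ^ 2 := by nlinarith
  have hs : 0 < √(x ^ 2 - ν ^ 2) := Real.sqrt_pos.2 h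
  have hs2 : √(x ^ 2 - ν ^ 2) ^ 2 = x ^ 2 - ν ^ 2 := Real.sq_sqrt h.le
  refine ((hasDerivAt_sqrt_sq_sub_sq h).div (hasDerivAt_id' x) hx0.ne').congr_deriv ?_
  field_simp
  linear_combination -hs2

theorem hasDerivAt_sq_div_sq_mul_sqrt {ν x : ℝ} (hν : 0 ≤ ν) (hx : ν < x) :
    HasDerivAt (fun y => ν ^ 2 / (y ^ 2 * √(y ^ 2 - ν ^ 2)))
      (-(ν ^ 2 * (3 * x ^ 2 - 2 * ν ^ 2)) / (x ^ 3 * √(x ^ 2 - ν ^ 2) ^ 3)) x := by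
  have hx0 : 0 < x := hν.trans_lt hx
  have h : 0 < x ^ 2 - ν ^ 2 := by nlinarith
  have hs : 0 < √(x ^ 2 - ν ^ 2) := Real.sqrt_pos.2 h
  have hs2 : √(x ^ 2 - ν ^ 2) ^ 2 = x ^ 2 - ν ^ 2 := Real.sq_sqrt h.le
  have hden := (hasDerivAt_pow 2 x).fun_mul (hasDerivAt_sqrt_sq_sub_sq h)
  refine ((hasDerivAt_const x (ν ^ 2)).div hden (mul_pos (pow_pos hx0 2) hs).ne').congr_deriv ?_
  field_simp
  norm_num
  linear_combination 2 * ν ^ 2 * x * hs2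

theorem deriv_thetaUp_eqOn {ν : ℝ} (hν : 0 ≤ ν) :
    Set.EqOn (deriv (thetaUp ν)) (fun x => √(x ^ 2 - ν ^ 2) / x) (Set.Ioi ν) :=
  fun _ hx => (hasDerivAt_thetaUp hν hx).deriv

theorem deriv_deriv_thetaUp_eqOn {ν : ℝ} (hν : 0 ≤ ν) :
    Set.EqOn (deriv (deriv (thetaUp ν))) (fun x => ν ^ 2 / (x ^ 2 * √(x ^ 2 - ν ^ 2)))
      (Set.Ioi ν) := fun _ hx =>
  ((deriv_thetaUp_eqOn hν).deriv isOpen_Ioi hx).trans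
    (hasDerivAt_sqrt_sq_sub_sq_div hν hx).deriv

theorem deriv_deriv_deriv_thetaUp {ν x : ℝ} (hν : 0 ≤ ν) (hx : ν < x) :
    deriv (deriv (deriv (thetaUp ν))) x =
      -(ν ^ 2 * (3 * x ^ 2 - 2 * ν ^ 2)) / (x ^ 3 * √(x ^ 2 - ν ^ 2) ^ 3) :=
  ((deriv_deriv_thetaUp_eqOn hν).deriv isOpen_Ioi hx).trans
    (hasDerivAt_sq_div_sq_mul_sqrt hν hx).deriv

theorem potential_thetaUp {ν x : ℝ} (hν : 0 ≤ ν) (hx : ν < x) :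
    potential (thetaUp ν) x =
      (x ^ 2 - ν ^ 2) / x ^ 2
        - (6 * ν ^ 2 * x ^ 2 - ν ^ 4) / (4 * x ^ 2 * (x ^ 2 - ν ^ 2) ^ 2) := by
  have hx0 : 0 < x := hν.trans_lt hx
  have h : 0 < x ^ 2 - ν ^ 2 := by nlinarith
  have hs : 0 < √(x ^ 2 - ν ^ 2) := Real.sqrt_pos.2 h
  have hs2 : √(x ^ 2 - ν ^ 2) ^ 2 = x ^ 2 - ν ^ 2 := Real.sq_sqrt h.le
  rw [potential, deriv_thetaUp_eqOn hν hx, deriv_deriv_thetaUp_eqOn hν hx,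
    deriv_deriv_deriv_thetaUp hν hx]
  simp only
  rw [← hs2, Real.sqrt_sq hs.le]
  field_simp
  ring

/-- The difference between the potential of `θup_ν` and the potential of the Bessel
derivative phase:
`V_{θup_ν}(x) − (1 − (ν² − 1/4)/x² − (2ν² + x²)/(x² − ν²)²) = (4ν² + 3x²)/(4(x² − ν²)²) > 0`. -/
theorem thetaUp_potential_sub_bessel_derivative_potential (ν : ℝ) (hν : 0 ≤ ν) :
    ∀ x, ν < x →
      potential (thetaUp ν) x
        - (1 - (ν ^ 2 - 1 / 4) / x ^ 2 - (2 * ν ^ 2 + x ^ 2) / (x ^ 2 - ν ^ 2) ^ 2)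
        = (4 * ν ^ 2 + 3 * x ^ 2) / (4 * (x ^ 2 - ν ^ 2) ^ 2) ∧
      1 - (ν ^ 2 - 1 / 4) / x ^ 2 - (2 * ν ^ 2 + x ^ 2) / (x ^ 2 - ν ^ 2) ^ 2
        < potential (thetaUp ν) x := by
  intro x hx
  have hx0 : 0 < x := hν.trans_lt hx
  have h : 0 < x ^ 2 - ν ^ 2 := by nlinarith
  have key : potential (thetaUp ν) x
      - (1 - (ν ^ 2 - 1 / 4) / x ^ 2 - (2 * ν ^ 2 + x ^ 2) / (x ^ 2 - ν ^ 2) ^ 2)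
      = (4 * ν ^ 2 + 3 * x ^ 2) / (4 * (x ^ 2 - ν ^ 2) ^ 2) := by
    rw [potential_thetaUp hν hx]
    field_simp
    ring
  refine ⟨key, sub_pos.1 ?_⟩
  rw [key]
  positivity
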